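/- Let $d\ge 1$. There exist constants $c>0$, $C>0$ and $\mu>0$ such that for all $t>0$ and all integers $n\ge 2$: $\sup_{x\in Q}\int_Q |G_d(t,x,y)-(G_d)^n(t,x,y)|\, dy \le C\, n^{-1}\,\bigl(1+t^{-\mu}\bigr)\, e^{-ct}$. -/

import Mathlib

open MeasureTheory

/-- `φ_j(ξ) = √2 sin(jπξ)`. -/
noncomputable def phiF (j : ℕ) (ξ : ℝ) : ℝ := Real.sqrt 2 * Real.sin ((j : ℝ) * Real.pi * ξ)

/-- Green function of the heat operator on `[0,1]` with homogeneous
Dirichlet boundary conditions: `G(t,x,y) = ∑_{j≥1} e^{-j²π²t} φ_j(x) φ_j(y)`. -/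
noncomputable def G (t x y : ℝ) : ℝ :=
  ∑' j : ℕ, Real.exp (-((j : ℝ) + 1) ^ 2 * Real.pi ^ 2 * t) * phiF (j + 1) x * phiF (j + 1) y

/-- The cube `Q = [0,1]^d`. -/
def Q (d : ℕ) : Set (EuclideanSpace ℝ (Fin d)) := {x | ∀ i, x i ∈ Set.Icc (0 : ℝ) 1}

/-- `G_d(t,x,y) = ∏_i G(t,x_i,y_i)` on `Q = [0,1]^d`. -/
noncomputable def Gd (d : ℕ) (t : ℝ) (x y : EuclideanSpace ℝ (Fin d)) : ℝ :=
  ∏ i, G t (x i) (y i)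

/-- `‖φ‖_{(α)}² = ∫_Q ∫_Q |φ(y)| |y-z|^{-α} |φ(z)| dy dz`. -/
noncomputable def normAlphaSq (d : ℕ) (α : ℝ) (f : EuclideanSpace ℝ (Fin d) → ℝ) : ℝ :=
  ∫ y in Q d, ∫ z in Q d, |f y| * ‖y - z‖ ^ (-α) * |f z|

/-- `κ_n(y) = ⌊ny⌋/n`. -/
noncomputable def kappa (n : ℕ) (y : ℝ) : ℝ := (⌊(n : ℝ) * y⌋ : ℝ) / n

/-- `λ_j^n = -4n² sin²(jπ/(2n))`. -/
noncomputable def lamn (n j : ℕ) : ℝ :=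
  -4 * (n : ℝ) ^ 2 * Real.sin ((j : ℝ) * Real.pi / (2 * n)) ^ 2

/-- Piecewise-linear interpolation of `φ_j` on the grid `{i/n : 0 ≤ i ≤ n}`. -/
noncomputable def phiLin (n j : ℕ) (x : ℝ) : ℝ :=
  phiF j ((⌊(n : ℝ) * x⌋ : ℝ) / n) +
    ((n : ℝ) * x - (⌊(n : ℝ) * x⌋ : ℝ)) *
      (phiF j (((⌊(n : ℝ) * x⌋ : ℝ) + 1) / n) - phiF j ((⌊(n : ℝ) * x⌋ : ℝ) / n))

/-- Space-discretized Green function on `[0,1]`: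
`G^n(t,x,y) = ∑_{j=1}^{n-1} e^{λ_j^n t} φ_j^n(x) φ_j(κ_n(y))`. -/
noncomputable def Gn (n : ℕ) (t x y : ℝ) : ℝ :=
  ∑ j ∈ Finset.Icc 1 (n - 1), Real.exp (lamn n j * t) * phiLin n j x * phiF j (kappa n y)

/-- `(G_d)^n(t,x,y) = ∏_i G^n(t,x_i,y_i)`. -/
noncomputable def Gdn (d n : ℕ) (t : ℝ) (x y : EuclideanSpace ℝ (Fin d)) : ℝ :=
  ∏ i, Gn n t (x i) (y i)

lemma phiF_abs_le (j : ℕ) (x : ℝ) : |phiF j x| ≤ Real.sqrt 2 := by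
  unfold phiF
  rw [abs_mul, abs_of_nonneg (Real.sqrt_nonneg 2)]
  exact mul_le_of_le_one_right (Real.sqrt_nonneg 2) (Real.abs_sin_le_one _)

lemma phiF_lip (j : ℕ) (x y : ℝ) :
    |phiF j x - phiF j y| ≤ Real.sqrt 2 * ((j : ℝ) * Real.pi * |x - y|) := by
  unfold phiF
  rw [← mul_sub, abs_mul, abs_of_nonneg (Real.sqrt_nonneg 2)]
  have h := Real.lipschitzWith_sin.dist_le_mul ((j : ℝ) * Real.pi * x) ((j : ℝ) * Real.pi * y)
  rw [Real.dist_eq, Real.dist_eq, ← mul_sub, abs_mul,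
    abs_of_nonneg (by positivity : (0 : ℝ) ≤ (j : ℝ) * Real.pi)] at h
  simp only [NNReal.coe_one, one_mul] at h
  exact mul_le_mul_of_nonneg_left h (Real.sqrt_nonneg 2)

lemma convex_abs (a b c θ B : ℝ) (h0 : 0 ≤ θ) (h1 : θ ≤ 1) (ha : |c - a| ≤ B) (hb : |c - b| ≤ B) :
    |c - (a + θ * (b - a))| ≤ B := by
  rw [abs_le] at *
  constructor <;> nlinarith

lemma phiLin_abs_le (n j : ℕ) (x : ℝ) : |phiLin n j x| ≤ Real.sqrt 2 := by
  have h := convex_abs (phiF j ((⌊(n : ℝ) * x⌋ : ℝ) / n)) (phiF j (((⌊(n : ℝ) * x⌋ : ℝ) + 1) / n))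
    0 ((n : ℝ) * x - (⌊(n : ℝ) * x⌋ : ℝ)) (Real.sqrt 2)
    (by linarith [Int.floor_le ((n : ℝ) * x)]) (by linarith [Int.lt_floor_add_one ((n : ℝ) * x)])
    (by rw [zero_sub, abs_neg]; exact phiF_abs_le _ _)
    (by rw [zero_sub, abs_neg]; exact phiF_abs_le _ _)
  rw [zero_sub, abs_neg] at h
  exact h

lemma grid_left (n : ℕ) (hn : 2 ≤ n) (x : ℝ) : |x - (⌊(n : ℝ) * x⌋ : ℝ) / n| ≤ (n : ℝ)⁻¹ := by
  have hn0 : (0 : ℝ) < n := by positivity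
  have e : x - (⌊(n : ℝ) * x⌋ : ℝ) / n = ((n : ℝ) * x - ⌊(n : ℝ) * x⌋) * (n : ℝ)⁻¹ := by
    field_simp
  rw [e, abs_mul, abs_of_pos (inv_pos.2 hn0)]
  refine mul_le_of_le_one_left (inv_pos.2 hn0).le ?_
  rw [abs_le]
  constructor <;> linarith [Int.floor_le ((n : ℝ) * x), Int.lt_floor_add_one ((n : ℝ) * x)]

lemma grid_right (n : ℕ) (hn : 2 ≤ n) (x : ℝ) :
    |x - ((⌊(n : ℝ) * x⌋ : ℝ) + 1) / n| ≤ (n : ℝ)⁻¹ := by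
  have hn0 : (0 : ℝ) < n := by positivity
  have e : x - ((⌊(n : ℝ) * x⌋ : ℝ) + 1) / n
      = ((n : ℝ) * x - (⌊(n : ℝ) * x⌋ + 1)) * (n : ℝ)⁻¹ := by
    field_simp
  rw [e, abs_mul, abs_of_pos (inv_pos.2 hn0)]
  refine mul_le_of_le_one_left (inv_pos.2 hn0).le ?_
  rw [abs_le]
  constructor <;> linarith [Int.floor_le ((n : ℝ) * x), Int.lt_floor_add_one ((n : ℝ) * x)]

lemma phiF_near (n j : ℕ) (x y : ℝ) (h : |x - y| ≤ (n : ℝ)⁻¹) :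
    |phiF j x - phiF j y| ≤ Real.sqrt 2 * ((j : ℝ) * Real.pi * (n : ℝ)⁻¹) :=
  (phiF_lip j x y).trans (by gcongr)

lemma phiLin_near (n j : ℕ) (hn : 2 ≤ n) (x : ℝ) :
    |phiF j x - phiLin n j x| ≤ Real.sqrt 2 * ((j : ℝ) * Real.pi * (n : ℝ)⁻¹) :=
  convex_abs _ _ _ _ _
    (by linarith [Int.floor_le ((n : ℝ) * x)]) (by linarith [Int.lt_floor_add_one ((n : ℝ) * x)])
    (phiF_near n j _ _ (grid_left n hn x)) (phiF_near n j _ _ (grid_right n hn x))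

lemma sq_sub_sin_sq (u : ℝ) (hu : 0 < u) : u ^ 2 - Real.sin u ^ 2 ≤ u ^ 3 := by
  rcases le_total u 1 with h | h
  · have h1 := Real.sin_gt_sub_cube hu
    have h2 := Real.sin_lt hu
    have h3 : 0 ≤ Real.sin u := Real.sin_nonneg_of_nonneg_of_le_pi hu.le
      (by linarith [Real.pi_gt_three])
    have h4 : u - Real.sin u ≤ u ^ 3 / 4 := by
      linarith [h1]
    have h5 : (u - Real.sin u) * (u + Real.sin u) ≤ u ^ 3 / 4 * (2 * u) := by
      apply mul_le_mul h4 (by linarith) (by linarith) (by positivity)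
    have h6 : u ^ 3 * u ≤ u ^ 3 * 1 := by gcongr
    nlinarith [pow_pos hu 3]
  · nlinarith [sq_nonneg (Real.sin u), pow_pos hu 2]

lemma lamn_le (n j : ℕ) (hn : 2 ≤ n) (hj : j ≤ n) : lamn n j ≤ -(4 * (j : ℝ) ^ 2) := by
  have hn0 : (0 : ℝ) < n := by positivity
  have hjn : (j : ℝ) ≤ n := by exact_mod_cast hj
  have h := Real.mul_le_sin (x := (j : ℝ) * Real.pi / (2 * n)) (by positivity) (by
    rw [div_le_div_iff₀ (by positivity) (by positivity)]
    nlinarith [Real.pi_pos])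
  have e : 2 / Real.pi * ((j : ℝ) * Real.pi / (2 * n)) = j / n := by
    field_simp
  rw [e] at h
  have h2 : ((j : ℝ) / n) ^ 2 ≤ Real.sin ((j : ℝ) * Real.pi / (2 * n)) ^ 2 := by gcongr
  have h3 : (n : ℝ) ^ 2 * ((j : ℝ) / n) ^ 2 = (j : ℝ) ^ 2 := by field_simp
  unfold lamn
  nlinarith [mul_le_mul_of_nonneg_left h2 (sq_nonneg (n : ℝ))]

lemma lamn_diff (n j : ℕ) (hn : 2 ≤ n) (hj : 1 ≤ j) :
    lamn n j + (j : ℝ) ^ 2 * Real.pi ^ 2 ≤ (j : ℝ) ^ 3 * Real.pi ^ 3 / 2 * (n : ℝ)⁻¹ := by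
  have hn0 : (0 : ℝ) < n := by positivity
  have hj0 : (0 : ℝ) < j := by exact_mod_cast hj
  have h := sq_sub_sin_sq ((j : ℝ) * Real.pi / (2 * n)) (by positivity)
  have h2 := mul_le_mul_of_nonneg_left h (by positivity : (0 : ℝ) ≤ 4 * (n : ℝ) ^ 2)
  have e1 : 4 * (n : ℝ) ^ 2 * ((j : ℝ) * Real.pi / (2 * n)) ^ 3
      = (j : ℝ) ^ 3 * Real.pi ^ 3 / 2 * (n : ℝ)⁻¹ := by field_simp; ring
  have e2 : 4 * (n : ℝ) ^ 2 * ((j : ℝ) * Real.pi / (2 * n)) ^ 2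
      = (j : ℝ) ^ 2 * Real.pi ^ 2 := by field_simp; ring
  rw [e1, mul_sub, e2] at h2
  unfold lamn
  linarith

lemma lamn_ge (n j : ℕ) (hn : 2 ≤ n) : 0 ≤ lamn n j + (j : ℝ) ^ 2 * Real.pi ^ 2 := by
  have hn0 : (0 : ℝ) < n := by positivity
  have h : Real.sin ((j : ℝ) * Real.pi / (2 * n)) ^ 2 ≤ ((j : ℝ) * Real.pi / (2 * n)) ^ 2 := by
    rw [sq_le_sq]; exact Real.abs_sin_le_abs
  have h2 := mul_le_mul_of_nonneg_left h (by positivity : (0 : ℝ) ≤ 4 * (n : ℝ) ^ 2)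
  have e2 : 4 * (n : ℝ) ^ 2 * ((j : ℝ) * Real.pi / (2 * n)) ^ 2
      = (j : ℝ) ^ 2 * Real.pi ^ 2 := by field_simp; ring
  rw [e2] at h2
  unfold lamn
  linarith

lemma exp_diff (a b : ℝ) (h : a ≤ b) : |Real.exp a - Real.exp b| ≤ (b - a) * Real.exp b := by
  rw [abs_sub_comm, abs_of_nonneg (sub_nonneg.2 (Real.exp_le_exp.2 h))]
  have h1 := Real.add_one_le_exp (a - b)
  have h2 : Real.exp a = Real.exp (a - b) * Real.exp b := by
    rw [← Real.exp_add]; ring_nf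
  rw [h2]
  nlinarith [Real.exp_pos b]

/-- decay of a summand -/
lemma decay (t J : ℝ) (ht : 0 < t) (hJ : 1 ≤ J) :
    J * Real.exp (-(3 * J ^ 2 * t)) ≤ ((t ^ 2)⁻¹ * Real.exp (-t)) * (J ^ 2)⁻¹ := by
  have e : Real.exp (-(3 * J ^ 2 * t)) = Real.exp (-(J ^ 2 * t)) * (Real.exp (2 * J ^ 2 * t))⁻¹ := by
    rw [← Real.exp_neg, ← Real.exp_add]; ring_nf
  have h1 : Real.exp (-(J ^ 2 * t)) ≤ Real.exp (-t) := by
    apply Real.exp_le_exp.2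
    nlinarith [mul_le_mul_of_nonneg_right (one_le_pow₀ hJ : 1 ≤ J ^ 2) ht.le]
  have hp : 0 < 2 * J ^ 2 * t := by positivity
  have h2 : J ^ 3 * t ^ 2 ≤ Real.exp (2 * J ^ 2 * t) := by
    have := Real.quadratic_le_exp_of_nonneg hp.le
    have h3 : J ^ 3 * t ^ 2 * 1 ≤ J ^ 3 * t ^ 2 * J := by gcongr
    nlinarith [pow_pos ht 2, pow_pos (by linarith : 0 < J) 4, mul_pos (pow_pos ht 2) (pow_pos (by linarith : 0 < J) 4)]
  have h3 : (Real.exp (2 * J ^ 2 * t))⁻¹ ≤ (J ^ 3 * t ^ 2)⁻¹ := by gcongr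
  rw [e]
  calc J * (Real.exp (-(J ^ 2 * t)) * (Real.exp (2 * J ^ 2 * t))⁻¹)
      ≤ J * (Real.exp (-t) * (J ^ 3 * t ^ 2)⁻¹) := by gcongr
    _ = _ := by field_simp

lemma exp4_le (t J : ℝ) (ht : 0 < t) (hJ : 1 ≤ J) :
    Real.exp (-(4 * J ^ 2 * t)) ≤ J * Real.exp (-(3 * J ^ 2 * t)) := by
  calc Real.exp (-(4 * J ^ 2 * t)) ≤ 1 * Real.exp (-(3 * J ^ 2 * t)) := by
        rw [one_mul]; apply Real.exp_le_exp.2; nlinarith [mul_pos (pow_pos (by linarith : 0 < J) 2) ht]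
    _ ≤ _ := by gcongr

lemma expPi_le (t J : ℝ) (ht : 0 < t) :
    Real.exp (-J ^ 2 * Real.pi ^ 2 * t) ≤ Real.exp (-(4 * J ^ 2 * t)) := by
  apply Real.exp_le_exp.2
  have : (4 : ℝ) ≤ Real.pi ^ 2 := by nlinarith [Real.pi_gt_three]
  nlinarith [mul_le_mul_of_nonneg_left this (by positivity : 0 ≤ J ^ 2 * t)]

/-- term of `G` -/
noncomputable def aT (t x y : ℝ) (j : ℕ) : ℝ :=
  Real.exp (-((j : ℝ) + 1) ^ 2 * Real.pi ^ 2 * t) * phiF (j + 1) x * phiF (j + 1) y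

/-- term of `Gn` -/
noncomputable def bT (n : ℕ) (t x y : ℝ) (j : ℕ) : ℝ :=
  if j < n - 1 then
    Real.exp (lamn n (j + 1) * t) * phiLin n (j + 1) x * phiF (j + 1) (kappa n y) else 0

lemma Gn_eq (n : ℕ) (t x y : ℝ) : Gn n t x y = ∑' j, bT n t x y j := by
  rw [tsum_eq_sum (s := Finset.range (n - 1))]
  · unfold Gn
    have : Finset.Icc 1 (n - 1) = (Finset.range (n - 1)).image (· + 1) := by
      ext k; simp only [Finset.mem_Icc, Finset.mem_image, Finset.mem_range]
      constructor
      · rintro ⟨h1, h2⟩; exact ⟨k - 1, by omega, by omega⟩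
      · rintro ⟨a, h1, h2⟩; omega
    rw [this, Finset.sum_image (by intro a _ b _ h; simpa using h)]
    refine Finset.sum_congr rfl fun k hk => ?_
    rw [bT, if_pos (Finset.mem_range.1 hk)]
  · intro k hk
    rw [bT, if_neg (by simpa using hk)]

lemma abs3 (e p q E : ℝ) (he : 0 ≤ e) (h : e ≤ E) (hp : |p| ≤ Real.sqrt 2) (hq : |q| ≤ Real.sqrt 2) :
    |e * p * q| ≤ 2 * E := by
  rw [abs_mul, abs_mul, abs_of_nonneg he]
  have hE : 0 ≤ E := he.trans h
  calc e * |p| * |q| ≤ E * Real.sqrt 2 * Real.sqrt 2 := by gcongr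
    _ = 2 * E := by rw [mul_assoc, Real.mul_self_sqrt (by norm_num)]; ring

/-- dominating sequence -/
noncomputable def dom (t : ℝ) (j : ℕ) : ℝ := ((t ^ 2)⁻¹ * Real.exp (-t)) * (((j : ℝ) + 1) ^ 2)⁻¹

lemma J1 (j : ℕ) : (1 : ℝ) ≤ (j : ℝ) + 1 := by linarith [(Nat.cast_nonneg j : (0 : ℝ) ≤ j)]

lemma aT_le4 (t x y : ℝ) (ht : 0 < t) (j : ℕ) :
    |aT t x y j| ≤ 2 * Real.exp (-(4 * ((j : ℝ) + 1) ^ 2 * t)) :=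
  abs3 _ _ _ _ (Real.exp_pos _).le (expPi_le t _ ht) (phiF_abs_le _ _) (phiF_abs_le _ _)

lemma aT_le (t x y : ℝ) (ht : 0 < t) (j : ℕ) : |aT t x y j| ≤ 2 * dom t j := by
  have := (exp4_le t _ ht (J1 j)).trans (decay t _ ht (J1 j))
  have := aT_le4 t x y ht j
  unfold dom; linarith

lemma explam_le (n j : ℕ) (t : ℝ) (ht : 0 < t) (hn : 2 ≤ n) (hj : j < n - 1) :
    Real.exp (lamn n (j + 1) * t) ≤ Real.exp (-(4 * ((j : ℝ) + 1) ^ 2 * t)) := by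
  apply Real.exp_le_exp.2
  have := mul_le_mul_of_nonneg_right (lamn_le n (j + 1) hn (by omega)) ht.le
  push_cast at this
  linarith

lemma bT_le (n : ℕ) (hn : 2 ≤ n) (t x y : ℝ) (ht : 0 < t) (j : ℕ) :
    |bT n t x y j| ≤ 2 * dom t j := by
  have h1 := (exp4_le t _ ht (J1 j)).trans (decay t _ ht (J1 j))
  unfold bT
  split_ifs with h
  · have h2 := abs3 _ _ _ _ (Real.exp_pos _).le (explam_le n j t ht hn h)
      (phiLin_abs_le n (j + 1) x) (phiF_abs_le (j + 1) (kappa n y))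
    unfold dom; linarith
  · rw [abs_zero]; unfold dom; positivity

lemma diff_le (n : ℕ) (hn : 2 ≤ n) (t x y : ℝ) (ht : 0 < t) (j : ℕ) :
    |aT t x y j - bT n t x y j| ≤ 60 * (n : ℝ)⁻¹ * dom t j := by
  have hn0 : (0 : ℝ) < n := by positivity
  have hd := decay t _ ht (J1 j)
  have h34 := exp4_le t _ ht (J1 j)
  have hJ := J1 j
  unfold bT
  split_ifs with h
  · have hE := explam_le n j t ht hn h
    have hlo := lamn_ge n (j + 1) hn
    have hup := lamn_diff n (j + 1) hn (by omega)
    have hx := phiLin_near n (j + 1) hn x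
    have hy := phiF_near n (j + 1) y (kappa n y) (grid_left n hn y)
    push_cast at hlo hup hx hy
    unfold aT
    set J : ℝ := (j : ℝ) + 1 with hJd
    set L := lamn n (j + 1)
    set E4 := Real.exp (-(4 * J ^ 2 * t))
    set E3 := Real.exp (-(3 * J ^ 2 * t)) with hE3
    set p := phiF (j + 1) x
    set q := phiF (j + 1) y
    set p' := phiLin n (j + 1) x
    set q' := phiF (j + 1) (kappa n y)
    set e := Real.exp (-J ^ 2 * Real.pi ^ 2 * t)
    set f := Real.exp (L * t)
    have hf : 0 ≤ f := (Real.exp_pos _).le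
    have hE4 : 0 ≤ E4 := (Real.exp_pos _).le
    have hE30 : 0 ≤ E3 := (Real.exp_pos _).le
    have hp : |p| ≤ Real.sqrt 2 := phiF_abs_le _ _
    have hq : |q| ≤ Real.sqrt 2 := phiF_abs_le _ _
    have hp' : |p'| ≤ Real.sqrt 2 := phiLin_abs_le _ _ _
    have s2 : Real.sqrt 2 * Real.sqrt 2 = 2 := Real.mul_self_sqrt (by norm_num)
    have hef : |e - f| ≤ (J ^ 3 * Real.pi ^ 3 / 2 * (n : ℝ)⁻¹) * t * E4 := by
      refine (exp_diff _ _ (by nlinarith)).trans ?_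
      have : L * t - -J ^ 2 * Real.pi ^ 2 * t = (L + J ^ 2 * Real.pi ^ 2) * t := by ring
      rw [this]
      gcongr
    have hte : t * J ^ 2 * E4 ≤ E3 := by
      have e1 : E3 = Real.exp (J ^ 2 * t) * E4 := by
        rw [hE3, ← Real.exp_add]; ring_nf
      rw [e1]
      gcongr
      linarith [Real.add_one_le_exp (J ^ 2 * t)]
    have split : e * p * q - f * p' * q' = (e - f) * p * q + f * (p - p') * q + f * p' * (q - q') := by
      ring
    have b1 : |(e - f) * p * q| ≤ (J ^ 3 * Real.pi ^ 3 / 2 * (n : ℝ)⁻¹) * t * E4 * 2 := by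
      rw [abs_mul, abs_mul]
      calc |e - f| * |p| * |q|
          ≤ ((J ^ 3 * Real.pi ^ 3 / 2 * (n : ℝ)⁻¹) * t * E4) * Real.sqrt 2 * Real.sqrt 2 := by gcongr
        _ = _ := by rw [mul_assoc _ (Real.sqrt 2) (Real.sqrt 2), s2]
    have b2 : |f * (p - p') * q| ≤ E4 * (J * Real.pi * (n : ℝ)⁻¹) * 2 := by
      rw [abs_mul, abs_mul, abs_of_nonneg hf]
      calc f * |p - p'| * |q| ≤ E4 * (Real.sqrt 2 * (J * Real.pi * (n : ℝ)⁻¹)) * Real.sqrt 2 := by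
            gcongr
        _ = E4 * (J * Real.pi * (n : ℝ)⁻¹) * (Real.sqrt 2 * Real.sqrt 2) := by ring
        _ = _ := by rw [s2]
    have b3 : |f * p' * (q - q')| ≤ E4 * (J * Real.pi * (n : ℝ)⁻¹) * 2 := by
      rw [abs_mul, abs_mul, abs_of_nonneg hf]
      calc f * |p'| * |q - q'| ≤ E4 * Real.sqrt 2 * (Real.sqrt 2 * (J * Real.pi * (n : ℝ)⁻¹)) := by
            gcongr
        _ = E4 * (J * Real.pi * (n : ℝ)⁻¹) * (Real.sqrt 2 * Real.sqrt 2) := by ring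
        _ = _ := by rw [s2]
    have hE43 : E4 ≤ E3 := by
      apply Real.exp_le_exp.2
      nlinarith [mul_pos (pow_pos (by linarith : 0 < J) 2) ht]
    have hpi : Real.pi ^ 3 + 4 * Real.pi ≤ 60 := by
      have h1 := Real.pi_lt_d2
      have h0 := Real.pi_pos
      have : Real.pi ^ 3 ≤ 3.15 ^ 3 := by gcongr
      norm_num at *
      linarith
    calc |e * p * q - f * p' * q'|
        ≤ |(e - f) * p * q| + |f * (p - p') * q| + |f * p' * (q - q')| := by
          rw [split]; exact abs_add_three _ _ _
      _ ≤ (J ^ 3 * Real.pi ^ 3 / 2 * (n : ℝ)⁻¹) * t * E4 * 2 + E4 * (J * Real.pi * (n : ℝ)⁻¹) * 2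
          + E4 * (J * Real.pi * (n : ℝ)⁻¹) * 2 := by linarith
      _ = J * Real.pi ^ 3 * (n : ℝ)⁻¹ * (t * J ^ 2 * E4) + J * (4 * Real.pi) * (n : ℝ)⁻¹ * E4 := by
          ring
      _ ≤ J * Real.pi ^ 3 * (n : ℝ)⁻¹ * E3 + J * (4 * Real.pi) * (n : ℝ)⁻¹ * E3 := by gcongr
      _ = (Real.pi ^ 3 + 4 * Real.pi) * (n : ℝ)⁻¹ * (J * E3) := by ring
      _ ≤ 60 * (n : ℝ)⁻¹ * dom t j := by
          unfold dom
          gcongr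
  · rw [sub_zero]
    have hnJ : (n : ℝ) ≤ (j : ℝ) + 1 := by
      have : n ≤ j + 1 := by omega
      exact_mod_cast this
    have h1 : 1 ≤ (n : ℝ)⁻¹ * ((j : ℝ) + 1) := by
      rw [inv_mul_eq_div, le_div_iff₀ hn0]; linarith
    have h2 := aT_le4 t x y ht j
    have hE43 : Real.exp (-(4 * ((j : ℝ) + 1) ^ 2 * t)) ≤ Real.exp (-(3 * ((j : ℝ) + 1) ^ 2 * t)) := by
      apply Real.exp_le_exp.2
      nlinarith [mul_pos (pow_pos (by linarith : 0 < (j : ℝ) + 1) 2) ht]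
    calc |aT t x y j| ≤ 2 * Real.exp (-(4 * ((j : ℝ) + 1) ^ 2 * t)) := h2
      _ ≤ 60 * (1 * Real.exp (-(3 * ((j : ℝ) + 1) ^ 2 * t))) := by
          linarith [Real.exp_pos (-(4 * ((j : ℝ) + 1) ^ 2 * t))]
      _ ≤ 60 * (((n : ℝ)⁻¹ * ((j : ℝ) + 1)) * Real.exp (-(3 * ((j : ℝ) + 1) ^ 2 * t))) := by gcongr
      _ = 60 * (n : ℝ)⁻¹ * (((j : ℝ) + 1) * Real.exp (-(3 * ((j : ℝ) + 1) ^ 2 * t))) := by ring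
      _ ≤ _ := by unfold dom; gcongr

/-- the sum of inverse squares -/
noncomputable def SS : ℝ := ∑' j : ℕ, (((j : ℝ) + 1) ^ 2)⁻¹

lemma summ : Summable (fun j : ℕ => (((j : ℝ) + 1) ^ 2)⁻¹) := by
  have h := (summable_nat_add_iff 1).2 (Real.summable_nat_pow_inv.2 (by norm_num : 1 < 2))
  simpa using h

lemma SS_nonneg : 0 ≤ SS := tsum_nonneg fun j => by positivity

lemma hasSum_dom (t : ℝ) : HasSum (dom t) (((t ^ 2)⁻¹ * Real.exp (-t)) * SS) :=
  summ.hasSum.mul_left _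

lemma G_le (t x y : ℝ) (ht : 0 < t) :
    |G t x y| ≤ 60 * (((t ^ 2)⁻¹ * Real.exp (-t)) * SS) := by
  have h := tsum_of_norm_bounded (f := aT t x y) ((hasSum_dom t).mul_left 2) (aT_le t x y ht)
  have h0 : 0 ≤ ((t ^ 2)⁻¹ * Real.exp (-t)) * SS := mul_nonneg (by positivity) SS_nonneg
  have h' : |G t x y| ≤ 2 * (((t ^ 2)⁻¹ * Real.exp (-t)) * SS) := h
  linarith

lemma Gn_le (n : ℕ) (hn : 2 ≤ n) (t x y : ℝ) (ht : 0 < t) :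
    |Gn n t x y| ≤ 60 * (((t ^ 2)⁻¹ * Real.exp (-t)) * SS) := by
  have h := tsum_of_norm_bounded (f := bT n t x y) ((hasSum_dom t).mul_left 2) (bT_le n hn t x y ht)
  have h0 : 0 ≤ ((t ^ 2)⁻¹ * Real.exp (-t)) * SS := mul_nonneg (by positivity) SS_nonneg
  rw [Gn_eq]
  rw [Real.norm_eq_abs] at h
  linarith

lemma G_diff (n : ℕ) (hn : 2 ≤ n) (t x y : ℝ) (ht : 0 < t) :
    |G t x y - Gn n t x y| ≤ 60 * (((t ^ 2)⁻¹ * Real.exp (-t)) * SS) * (n : ℝ)⁻¹ := by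
  have h := tsum_of_norm_bounded (f := fun j => aT t x y j - bT n t x y j)
    ((hasSum_dom t).mul_left (60 * (n : ℝ)⁻¹)) (diff_le n hn t x y ht)
  have sa : Summable (aT t x y) :=
    Summable.of_norm_bounded ((hasSum_dom t).mul_left 2).summable (aT_le t x y ht)
  have sb : Summable (bT n t x y) :=
    Summable.of_norm_bounded ((hasSum_dom t).mul_left 2).summable (bT_le n hn t x y ht)
  rw [sa.tsum_sub sb, ← Gn_eq, Real.norm_eq_abs] at h
  have h' : |G t x y - Gn n t x y| ≤ 60 * (n : ℝ)⁻¹ * (((t ^ 2)⁻¹ * Real.exp (-t)) * SS) := h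
  linarith

lemma prod_diff {ι : Type*} (s : Finset ι) (a b : ι → ℝ) (M r : ℝ) (hM : 0 ≤ M)
    (ha : ∀ i, |a i| ≤ M) (hb : ∀ i, |b i| ≤ M) (hab : ∀ i, |a i - b i| ≤ M * r) :
    |∏ i ∈ s, a i - ∏ i ∈ s, b i| ≤ s.card * M ^ s.card * r := by
  classical
  induction s using Finset.induction_on with
  | empty => simp
  | insert i s hi ih =>
    rw [Finset.prod_insert hi, Finset.prod_insert hi, Finset.card_insert_of_notMem hi]
    have hP : |∏ i ∈ s, b i| ≤ M ^ s.card := by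
      rw [Finset.abs_prod]
      exact (Finset.prod_le_prod (fun i _ => abs_nonneg _) (fun i _ => hb i)).trans
        (by rw [Finset.prod_const])
    have e : a i * ∏ i ∈ s, a i - b i * ∏ i ∈ s, b i
        = a i * (∏ i ∈ s, a i - ∏ i ∈ s, b i) + (a i - b i) * ∏ i ∈ s, b i := by ring
    rw [e]
    have h0 : 0 ≤ M * r := (abs_nonneg _).trans (hab i)
    calc _ ≤ |a i * (∏ i ∈ s, a i - ∏ i ∈ s, b i)| + |(a i - b i) * ∏ i ∈ s, b i| := abs_add_le _ _
      _ ≤ M * (s.card * M ^ s.card * r) + (M * r) * M ^ s.card := by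
          rw [abs_mul, abs_mul]
          have := ha i
          have := hab i
          gcongr
      _ = _ := by push_cast; ring

lemma Q_finite (d : ℕ) : volume (Q d) < ⊤ := by
  apply Bornology.IsBounded.measure_lt_top
  refine (Metric.isBounded_iff_subset_closedBall 0).2 ⟨Real.sqrt d, fun x hx => ?_⟩
  rw [mem_closedBall_zero_iff, EuclideanSpace.norm_eq]
  apply Real.sqrt_le_sqrt
  calc ∑ i, ‖x i‖ ^ 2 ≤ ∑ _i : Fin d, (1 : ℝ) := by
        refine Finset.sum_le_sum fun i _ => ?_
        have := hx i
        rw [Real.norm_eq_abs, sq_abs]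
        nlinarith [this.1, this.2]
    _ = d := by simp

/-- `L¹` estimate of `G_d - (G_d)^n`. -/
theorem stmt_13 (d : ℕ) (hd : 1 ≤ d) :
    ∃ c C μ : ℝ, 0 < c ∧ 0 < C ∧ 0 < μ ∧ ∀ t : ℝ, 0 < t → ∀ n : ℕ, 2 ≤ n → ∀ x ∈ Q d,
      (∫ y in Q d, |Gd d t x y - Gdn d n t x y|)
        ≤ C * (n : ℝ)⁻¹ * (1 + t ^ (-μ)) * Real.exp (-c * t) := by
  have hd0 : (0 : ℝ) < d := by exact_mod_cast hd
  have hS := SS_nonneg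
  set K : ℝ := d * (60 * SS) ^ d * (volume (Q d)).toReal with hK
  have hK0 : 0 ≤ K := by positivity
  refine ⟨d, K + 1, 2 * d, hd0, by linarith, by linarith, ?_⟩
  intro t ht n hn x _
  have hn0 : (0 : ℝ) < n := by positivity
  have h1 : ∀ y ∈ Q d, ‖|Gd d t x y - Gdn d n t x y|‖
      ≤ d * (60 * (((t ^ 2)⁻¹ * Real.exp (-t)) * SS)) ^ d * (n : ℝ)⁻¹ := by
    intro y _
    have h := prod_diff (Finset.univ : Finset (Fin d)) (fun i => G t (x i) (y i))
      (fun i => Gn n t (x i) (y i)) (60 * (((t ^ 2)⁻¹ * Real.exp (-t)) * SS)) ((n : ℝ)⁻¹)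
      (by positivity) (fun i => G_le t _ _ ht) (fun i => Gn_le n hn t _ _ ht)
      (fun i => G_diff n hn t _ _ ht)
    rw [Finset.card_univ, Fintype.card_fin] at h
    rw [Real.norm_eq_abs, abs_abs]
    exact h
  have h2 := norm_setIntegral_le_of_norm_le_const (Q_finite d) h1
  refine (Real.le_norm_self _).trans (h2.trans ?_)
  have e1 : t ^ (-(2 * (d : ℝ))) = ((t ^ 2)⁻¹) ^ d := by
    rw [Real.rpow_neg ht.le, inv_pow, ← pow_mul, ← Real.rpow_natCast]
    push_cast; rfl
  have e2 : Real.exp (-(d : ℝ) * t) = Real.exp (-t) ^ d := by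
    rw [← Real.exp_nat_mul]; ring_nf
  rw [e1, e2]
  have e3 : d * (60 * (((t ^ 2)⁻¹ * Real.exp (-t)) * SS)) ^ d * (n : ℝ)⁻¹ * volume.real (Q d)
      = K * (n : ℝ)⁻¹ * ((t ^ 2)⁻¹) ^ d * Real.exp (-t) ^ d := by
    rw [hK, mul_pow, mul_pow, mul_pow, mul_pow, Measure.real]; ring
  rw [e3]
  gcongr
  · linarith
  · linarith
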